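/- The following two conditions are equivalent: (1) there exists c > 0 such that for all (p₁, p₂) ∈ P₁ × P₂, sup over nonzero v ∈ U of (b₁(v,p₁) + b₂(v,p₂))/‖v‖ is at least c·(‖p₁‖ + ‖p₂‖); (2) there exists c > 0 such that for all p₁ ∈ P₁, sup over nonzero v ∈ U of b₁(v,p₁)/‖v‖ is at least c·‖p₁‖, and for all p₂ ∈ P₂, sup over nonzero v ∈ Z_{b₁} of b₂(v,p₂)/‖v‖ is at least c·‖p₂‖. -/

import Mathlib

open NormedSpace


lemma aux_div_le {U : Type*} [NormedAddCommGroup U] [NormedSpace ℝ U] (f : U →L[ℝ] ℝ) (v : U) :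
    f v / ‖v‖ ≤ ‖f‖ := by
  apply div_le_of_le_mul₀ (norm_nonneg _) (norm_nonneg _)
  exact (le_abs_self _).trans (f.le_opNorm v)

lemma aux_sup_le {U : Type*} [NormedAddCommGroup U] [NormedSpace ℝ U] (f : U →L[ℝ] ℝ)
    (q : U → Prop) : ⨆ v : {v : U // q v}, f v.1 / ‖v.1‖ ≤ ‖f‖ :=
  Real.iSup_le (fun v => aux_div_le f v.1) (norm_nonneg _)

lemma aux_le_sup {U : Type*} [NormedAddCommGroup U] [NormedSpace ℝ U] (f : U →L[ℝ] ℝ)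
    (q : U → Prop) (v : U) (hv : q v) :
    f v / ‖v‖ ≤ ⨆ v : {v : U // q v}, f v.1 / ‖v.1‖ := by
  have hb : BddAbove (Set.range fun v : {v : U // q v} => f v.1 / ‖v.1‖) := by
    refine ⟨‖f‖, ?_⟩
    rintro _ ⟨v, rfl⟩
    exact aux_div_le f v.1
  exact le_ciSup hb ⟨v, hv⟩

lemma aux_norm_le {U : Type*} [NormedAddCommGroup U] [NormedSpace ℝ U] (f : U →L[ℝ] ℝ)
    (S : Submodule ℝ U) (q : U → Prop) (hq : ∀ v, v ∈ S → v ≠ 0 → q v)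
    (hq' : ∀ v, q v → v ∈ S ∧ v ≠ 0) :
    ‖f.comp S.subtypeL‖ ≤ ⨆ v : {v : U // q v}, f v.1 / ‖v.1‖ := by
  have key : ∀ v ∈ S, v ≠ 0 → f v ≤ (⨆ v : {v : U // q v}, f v.1 / ‖v.1‖) * ‖v‖ := by
    intro v hv h0
    rw [← div_le_iff₀ (norm_pos_iff.2 h0)]
    exact aux_le_sup f q v (hq v hv h0)
  have key2 : ∀ v ∈ S, v ≠ 0 → |f v| ≤ (⨆ v : {v : U // q v}, f v.1 / ‖v.1‖) * ‖v‖ := by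
    intro v hv h0
    refine abs_le.2 ⟨?_, key v hv h0⟩
    have := key (-v) (S.neg_mem hv) (neg_ne_zero.2 h0)
    rw [map_neg, norm_neg] at this
    linarith
  refine ContinuousLinearMap.opNorm_le_bound _ ?_ ?_
  · by_cases h : ∃ v, q v
    · obtain ⟨v, hv⟩ := h
      obtain ⟨h1, h2⟩ := hq' v hv
      have := (abs_nonneg _).trans (key2 v h1 h2)
      exact nonneg_of_mul_nonneg_left this (norm_pos_iff.2 h2)
    · have : IsEmpty {v : U // q v} := ⟨fun v => h ⟨v.1, v.2⟩⟩
      rw [Real.iSup_of_isEmpty]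
  · intro v
    by_cases h0 : (v : U) = 0
    · have : v = 0 := Subtype.ext h0
      simp [this]
    · exact key2 v v.2 h0

lemma aux_norm_le_top {U : Type*} [NormedAddCommGroup U] [NormedSpace ℝ U] (f : U →L[ℝ] ℝ) :
    ‖f‖ ≤ ⨆ v : {v : U // v ≠ 0}, f v.1 / ‖v.1‖ := by
  have h := aux_norm_le f ⊤ (fun v => v ≠ 0) (fun _ _ h => h) (fun _ h => ⟨trivial, h⟩)
  refine le_trans ?_ h
  refine ContinuousLinearMap.opNorm_le_bound _ (ContinuousLinearMap.opNorm_nonneg _) fun v => ?_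
  exact (f.comp (⊤ : Submodule ℝ U).subtypeL).le_opNorm ⟨v, trivial⟩

/-- Closed range: functionals vanishing on the kernel lie in the range. -/
lemma aux_range {U P : Type*} [NormedAddCommGroup U] [NormedSpace ℝ U]
    [NormedAddCommGroup P] [NormedSpace ℝ P] [CompleteSpace P]
    (hU : Function.Surjective (inclusionInDoubleDual ℝ U))
    (T : P →L[ℝ] StrongDual ℝ U) (c : ℝ) (hc : 0 < c) (hT : ∀ p, c * ‖p‖ ≤ ‖T p‖)
    (h : StrongDual ℝ U) (hh : ∀ v, (∀ p, T p v = 0) → h v = 0) : ∃ p, T p = h := by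
  by_contra hn
  have hanti : AntilipschitzWith (Real.toNNReal c⁻¹) T := by
    refine T.antilipschitz_of_bound fun x => ?_
    rw [Real.coe_toNNReal _ (inv_pos.2 hc).le, inv_mul_eq_div, le_div_iff₀ hc, mul_comm]
    exact hT x
  have hcl : IsClosed (T.range : Set (StrongDual ℝ U)) := by
    have := hanti.isClosed_range T.uniformContinuous
    rw [LinearMap.coe_range]
    exact this
  have hnm : h ∉ T.range := by
    rintro ⟨p, hp⟩
    exact hn ⟨p, hp⟩
  obtain ⟨φ, u, h1, h2⟩ := geometric_hahn_banach_closed_point (T.range.convex) hcl hnm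
  have hz : ∀ p, φ (T p) = 0 := by
    intro p
    by_contra hne
    have h3 := h1 (T (((u + 1) / φ (T p)) • p)) ⟨_, rfl⟩
    rw [map_smul, map_smul, smul_eq_mul, div_mul_cancel₀ _ hne] at h3
    linarith
  have hu : 0 < u := by
    have := h1 (T 0) ⟨0, rfl⟩
    simpa using this
  obtain ⟨w, rfl⟩ := hU φ
  have := hh w (fun p => by simpa using hz p)
  simp only [dual_def] at h2
  linarith

/-- Equivalence of the combined inf-sup condition with the two individual
inf-sup conditions, for continuous bilinear forms on reflexive real Banach
spaces. -/
theorem stmt_5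
    (U P₁ P₂ : Type*)
    [NormedAddCommGroup U] [NormedSpace ℝ U] [CompleteSpace U]
    [NormedAddCommGroup P₁] [NormedSpace ℝ P₁] [CompleteSpace P₁]
    [NormedAddCommGroup P₂] [NormedSpace ℝ P₂] [CompleteSpace P₂]
    (hU : Function.Surjective (inclusionInDoubleDual ℝ U))
    (hP₁ : Function.Surjective (inclusionInDoubleDual ℝ P₁))
    (hP₂ : Function.Surjective (inclusionInDoubleDual ℝ P₂))
    (b₁ : U →L[ℝ] P₁ →L[ℝ] ℝ) (b₂ : U →L[ℝ] P₂ →L[ℝ] ℝ) :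
    (∃ c : ℝ, 0 < c ∧ ∀ p₁ : P₁, ∀ p₂ : P₂,
        c * (‖p₁‖ + ‖p₂‖) ≤ ⨆ v : {v : U // v ≠ 0}, (b₁ v.1 p₁ + b₂ v.1 p₂) / ‖v.1‖)
    ↔
    (∃ c : ℝ, 0 < c ∧
        (∀ p₁ : P₁, c * ‖p₁‖ ≤ ⨆ v : {v : U // v ≠ 0}, b₁ v.1 p₁ / ‖v.1‖) ∧
        (∀ p₂ : P₂, c * ‖p₂‖ ≤
          ⨆ v : {v : U // (∀ q₁ : P₁, b₁ v q₁ = 0) ∧ v ≠ 0}, b₂ v.1 p₂ / ‖v.1‖)) := by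
  have e1 : ∀ p₁ p₂ v, (b₁.flip p₁ + b₂.flip p₂) v = b₁ v p₁ + b₂ v p₂ := fun _ _ _ => rfl
  let Z : Submodule ℝ U := b₁.ker
  have hZ : ∀ v, v ∈ Z ↔ ∀ q, b₁ v q = 0 := by
    intro v
    constructor
    · intro h q
      have : b₁ v = 0 := h
      simp [this]
    · intro h
      exact (ContinuousLinearMap.ext h : b₁ v = 0)
  constructor
  · rintro ⟨c, hc, H⟩
    have H' : ∀ p₁ p₂, c * (‖p₁‖ + ‖p₂‖) ≤ ‖b₁.flip p₁ + b₂.flip p₂‖ := fun p₁ p₂ =>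
      (H p₁ p₂).trans (aux_sup_le (b₁.flip p₁ + b₂.flip p₂) (fun v => v ≠ 0))
    refine ⟨c, hc, fun p₁ => by simpa using H p₁ 0, fun p₂ => ?_⟩
    refine le_trans ?_ (aux_norm_le (b₂.flip p₂) Z (fun v => (∀ q₁ : P₁, b₁ v q₁ = 0) ∧ v ≠ 0)
      (fun v h1 h2 => ⟨(hZ v).1 h1, h2⟩) (fun v h => ⟨(hZ v).2 h.1, h.2⟩))
    obtain ⟨g, hg1, hg2⟩ := exists_extension_norm_eq Z ((b₂.flip p₂).comp Z.subtypeL)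
    obtain ⟨p, hp⟩ := aux_range hU b₁.flip c hc (fun p => by simpa using H' p 0)
      (g - b₂.flip p₂) (fun v hv => by
        have := hg1 ⟨v, (hZ v).2 hv⟩
        simp only [ContinuousLinearMap.sub_apply]
        rw [sub_eq_zero]
        exact this)
    rw [← hg2]
    have h3 := H' p p₂
    rw [hp, sub_add_cancel] at h3
    have := mul_nonneg hc.le (norm_nonneg p)
    linarith
  · rintro ⟨c, hc, H1, H2⟩
    have hB := norm_nonneg b₂
    have hK : 0 < 1 + ‖b₂‖ / c + 1 := by positivity
    refine ⟨c / (1 + ‖b₂‖ / c + 1), by positivity, fun p₁ p₂ => ?_⟩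
    refine le_trans ?_ (aux_norm_le_top (b₁.flip p₁ + b₂.flip p₂))
    have h2 : c * ‖p₂‖ ≤ ‖b₁.flip p₁ + b₂.flip p₂‖ := by
      refine (H2 p₂).trans (le_trans (le_of_eq ?_) (aux_sup_le (b₁.flip p₁ + b₂.flip p₂)
        (fun v => (∀ q₁ : P₁, b₁ v q₁ = 0) ∧ v ≠ 0)))
      congr 1
      funext v
      rw [e1, v.2.1, zero_add]
    have h1 : c * ‖p₁‖ ≤ ‖b₁.flip p₁‖ :=
      (H1 p₁).trans (aux_sup_le (b₁.flip p₁) (fun v => v ≠ 0))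
    have h3 : ‖b₁.flip p₁‖ ≤ ‖b₁.flip p₁ + b₂.flip p₂‖ + ‖b₂.flip p₂‖ := by
      have := norm_sub_le (b₁.flip p₁ + b₂.flip p₂) (b₂.flip p₂)
      rwa [add_sub_cancel_right] at this
    have h4 : ‖b₂.flip p₂‖ ≤ ‖b₂‖ * ‖p₂‖ := by
      have := b₂.flip.le_opNorm p₂
      rwa [ContinuousLinearMap.opNorm_flip] at this
    generalize ‖b₁.flip p₁ + b₂.flip p₂‖ = N at *
    have h5 : ‖b₂‖ * ‖p₂‖ ≤ ‖b₂‖ / c * N := by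
      rw [div_mul_eq_mul_div, le_div_iff₀ hc, mul_assoc]
      exact mul_le_mul_of_nonneg_left (by linarith) hB
    rw [div_mul_eq_mul_div, div_le_iff₀ hK]
    nlinarith
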